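/- A group G has cofinality ≠ ω if and only if every action of G by isometries on an ultrametric space has bounded orbits. -/

import Mathlib

/-- A group `G` has cofinality `ω` if it is the union of a strictly increasing sequence
of proper subgroups indexed by `ℕ`. -/
def CofinalityOmega (G : Type) [Group G] : Prop :=
  ∃ H : ℕ → Subgroup G, StrictMono H ∧ (∀ n, H n ≠ ⊤) ∧ (⋃ n, (H n : Set G)) = Set.univ

/-- A monotone exhaustion by proper subgroups can be thinned out to a strictly increasing one. -/
theorem CofinalityOmega.of_monotone {G : Type} [Group G] {H : ℕ → Subgroup G} (hH : Monotone H)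
    (hproper : ∀ n, H n ≠ ⊤) (hcover : ∀ g, ∃ n, g ∈ H n) : CofinalityOmega G := by
  have hlt (n : ℕ) : ∃ m, H n < H m := by
    obtain ⟨g, hg⟩ : ∃ g, g ∉ H n := by
      by_contra! h
      exact hproper n ((Subgroup.eq_top_iff' _).2 h)
    obtain ⟨m, hm⟩ := hcover g
    have hnm : n ≤ m := (le_total n m).resolve_right fun h => hg (hH h hm)
    exact ⟨m, (hH hnm).lt_of_ne fun h => hg (h ▸ hm)⟩
  choose f hf using hlt
  have hf_mono : StrictMono fun k => f^[k] 0 := strictMono_nat_of_lt_succ fun k => by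
    rw [Function.iterate_succ_apply']
    exact hH.reflect_lt (hf _)
  refine ⟨fun k => H (f^[k] 0), strictMono_nat_of_lt_succ fun k => ?_, fun _ => hproper _, ?_⟩
  · rw [Function.iterate_succ_apply']
    exact hf _
  · refine Set.eq_univ_of_forall fun g => ?_
    obtain ⟨n, hn⟩ := hcover g
    exact Set.mem_iUnion.2 ⟨n, hH (hf_mono.id_le n) hn⟩

/-- The elements moving `x` by at most `r`, for an isometric action on an ultrametric space. -/
def displacementSubgroup {G X : Type*} [Group G] [MetricSpace X]
    (hX : ∀ x y z : X, dist x z ≤ max (dist x y) (dist y z))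
    (φ : G →* (X ≃ᵢ X)) (x : X) (r : ℝ) (hr : 0 ≤ r) : Subgroup G where
  carrier := {g | dist (φ g x) x ≤ r}
  one_mem' := by simpa using hr
  mul_mem' {a b} ha hb := by
    refine (hX _ (φ a x) _).trans (max_le ?_ ha)
    rw [map_mul, IsometryEquiv.mul_apply, IsometryEquiv.dist_eq]
    exact hb
  inv_mem' {a} ha := by
    have h := (φ a).dist_eq (φ a⁻¹ x) x
    rw [← IsometryEquiv.mul_apply, ← map_mul, mul_inv_cancel, map_one, IsometryEquiv.coe_one,
      id_eq, dist_comm] at h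
    exact h.symm.trans_le ha

/-- A monotone exhaustion of a group by subgroups starting at `⊥` is the family of balls around `1`
of a natural-number-valued length function. -/
theorem exists_length_le_iff_mem {G : Type*} [Group G] {K : ℕ → Subgroup G} (hK : Monotone K)
    (hcover : ∀ g, ∃ n, g ∈ K n) : ∃ ν : G → ℕ, ∀ g n, ν g ≤ n ↔ g ∈ K n := by
  classical
  refine ⟨fun g => Nat.find (hcover g), fun g n => ?_⟩
  rw [Nat.find_le_iff]
  exact ⟨fun ⟨m, hm, hg⟩ => hK hm hg, fun hg => ⟨n, le_rfl, hg⟩⟩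

/-- A group of cofinality `ω` carries an unbounded left-invariant ultrametric. -/
theorem CofinalityOmega.exists_metricSpace {G : Type} [Group G] (hG : CofinalityOmega G) :
    ∃ _ : MetricSpace G, (∀ x y z : G, dist x z ≤ max (dist x y) (dist y z)) ∧
      (∀ a x y : G, dist (a * x) (a * y) = dist x y) ∧
      ¬ Bornology.IsBounded (Set.univ : Set G) := by
  obtain ⟨H, hH, hproper, hunion⟩ := hG
  let K : ℕ → Subgroup G := fun n => Nat.casesOn n ⊥ H
  have hK : Monotone K := monotone_nat_of_le_succ fun n => by
    cases n with
    | zero => exact bot_le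
    | succ n => exact hH.monotone n.le_succ
  have hcover (g : G) : ∃ n, g ∈ K n := by
    obtain ⟨n, hn⟩ := Set.mem_iUnion.1 (hunion ▸ Set.mem_univ g)
    exact ⟨n + 1, hn⟩
  obtain ⟨ν, hν⟩ := exists_length_le_iff_mem hK hcover
  have hν_self (g : G) : g ∈ K (ν g) := (hν g _).1 le_rfl
  have hν_one : ν 1 = 0 := Nat.le_zero.1 ((hν 1 0).2 (one_mem _))
  have hν_inv (g : G) : ν g⁻¹ = ν g :=
    le_antisymm ((hν _ _).2 (inv_mem (hν_self g)))
      ((hν _ _).2 (inv_mem_iff.1 (hν_self g⁻¹)))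
  have hν_mul (a b : G) : ν (a * b) ≤ max (ν a) (ν b) :=
    (hν _ _).2 (mul_mem (hK (le_max_left _ _) (hν_self a)) (hK (le_max_right _ _) (hν_self b)))
  have hultra (x y z : G) :
      (ν (x⁻¹ * z) : ℝ) ≤ max (ν (x⁻¹ * y) : ℝ) (ν (y⁻¹ * z) : ℝ) := by
    have h := hν_mul (x⁻¹ * y) (y⁻¹ * z)
    rw [show x⁻¹ * y * (y⁻¹ * z) = x⁻¹ * z by group] at h
    exact_mod_cast h
  let m : MetricSpace G :=
    { dist := fun x y => ν (x⁻¹ * y)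
      dist_self := fun x => by simp [hν_one]
      dist_comm := fun x y => by rw [← hν_inv (x⁻¹ * y), mul_inv_rev, inv_inv]
      dist_triangle := fun x y z => (hultra x y z).trans
        (max_le_add_of_nonneg (Nat.cast_nonneg _) (Nat.cast_nonneg _))
      eq_of_dist_eq_zero := fun {x y} h => by
        have h' : x⁻¹ * y ∈ K 0 := (hν _ _).1 (Nat.cast_eq_zero.1 h).le
        exact inv_mul_eq_one.1 (Subgroup.mem_bot.1 h') }
  refine ⟨m, hultra, fun a x y => ?_, fun hb => ?_⟩
  · change (ν ((a * x)⁻¹ * (a * y)) : ℝ) = ν (x⁻¹ * y)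
    rw [show (a * x)⁻¹ * (a * y) = x⁻¹ * y by group]
  · obtain ⟨C, hC⟩ := Metric.isBounded_iff.1 hb
    obtain ⟨n, hn⟩ := exists_nat_ge C
    refine hproper n ((Subgroup.eq_top_iff' _).2 fun g => ?_)
    have h : (ν (1⁻¹ * g) : ℝ) ≤ n := (hC (Set.mem_univ 1) (Set.mem_univ g)).trans hn
    rw [inv_one, one_mul, Nat.cast_le] at h
    exact (hν g (n + 1)).1 (h.trans n.le_succ)

/-- A group `G` has cofinality `≠ ω` if and only if every action of `G` by isometries on
an ultrametric space has bounded orbits. -/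
theorem not_cofinalityOmega_iff_ultrametric_orbits_bounded (G : Type) [Group G] :
    ¬ CofinalityOmega G ↔
      ∀ (X : Type) [MetricSpace X],
        (∀ x y z : X, dist x z ≤ max (dist x y) (dist y z)) →
        ∀ (φ : G →* (X ≃ᵢ X)) (x : X),
          Bornology.IsBounded (Set.range fun g : G => φ g x) := by
  constructor
  · intro hG X _ hX φ x
    by_contra hb
    refine hG (CofinalityOmega.of_monotone
      (H := fun n => displacementSubgroup hX φ x n n.cast_nonneg)
      (fun m n hmn g (hg : dist (φ g x) x ≤ m) =>
        show dist (φ g x) x ≤ n from hg.trans (Nat.cast_le.2 hmn))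
      (fun n hn => hb ?_) fun g => exists_nat_ge (dist (φ g x) x))
    refine (Metric.isBounded_closedBall (x := x) (r := n)).subset ?_
    rintro _ ⟨g, rfl⟩
    exact (Subgroup.eq_top_iff' _).1 hn g
  · intro h hG
    obtain ⟨m, hultra, hinv, hb⟩ := hG.exists_metricSpace
    let φ : G →* (G ≃ᵢ G) :=
      { toFun := fun a => ⟨Equiv.mulLeft a, Isometry.of_dist_eq (hinv a)⟩
        map_one' := by ext; simp
        map_mul' := fun a b => by ext; simp }
    exact hb ((h G hultra φ 1).subset fun g _ => ⟨g, mul_one g⟩)
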